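/- For any totally regular Q-semicategory B, its Cauchy completion B_cc is a Cauchy complete totally regular Q-semicategory: every left adjoint regular semidistributor into B_cc in TRSDist(Q) converges to a regular semifunctor. -/

import Mathlib

open CategoryTheory

universe u

variable (Q : Type u) [SmallCategory Q] [∀ X Y : Q, CompleteLattice (X ⟶ Y)]

/-- A (small) quantaloid: a category whose hom-sets are complete lattices and in which
composition distributes on both sides over arbitrary suprema. -/
class IsQuantaloid : Prop where
  comp_sSup : ∀ {X Y Z : Q} (f : X ⟶ Y) (S : Set (Y ⟶ Z)),
      f ≫ sSup S = ⨆ g ∈ S, f ≫ g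
  sSup_comp : ∀ {X Y Z : Q} (S : Set (X ⟶ Y)) (g : Y ⟶ Z),
      sSup S ≫ g = ⨆ f ∈ S, f ≫ g

/-- A `Q`-typed set together with a matrix of hom-arrows.  `A.hom a a' : A.ty a ⟶ A.ty a'`
is the hom-arrow written `A(a',a) : ta → ta'` in the paper. -/
structure QGraph where
  Obj : Type u
  ty : Obj → Q
  hom : ∀ a a' : Obj, ty a ⟶ ty a'

variable {Q}

namespace QGraph

/-- `Q`-semicategory: composition inequality. -/
def IsSemiCat (A : QGraph Q) : Prop :=
  ∀ a a' a'' : A.Obj, A.hom a a' ≫ A.hom a' a'' ≤ A.hom a a''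

/-- Regular `Q`-semicategory. -/
def IsRegular (A : QGraph Q) : Prop :=
  A.IsSemiCat ∧ ∀ a a'' : A.Obj, (⨆ a' : A.Obj, A.hom a a' ≫ A.hom a' a'') = A.hom a a''

/-- Totally regular `Q`-semicategory (elementary characterization):
`A(a,a)∘A(a,a') = A(a,a')` and `A(a',a)∘A(a,a) = A(a',a)`. -/
def IsTR (A : QGraph Q) : Prop :=
  A.IsSemiCat ∧ (∀ a a' : A.Obj, A.hom a a ≫ A.hom a a' = A.hom a a')
    ∧ (∀ a a' : A.Obj, A.hom a' a ≫ A.hom a a = A.hom a' a)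

/-- `Q`-category: composition inequality plus unit inequality. -/
def IsCat (A : QGraph Q) : Prop :=
  A.IsSemiCat ∧ ∀ a : A.Obj, 𝟙 (A.ty a) ≤ A.hom a a

/-- Normal `Q`-category: all endo-hom-arrows are identities. -/
def IsNormal (A : QGraph Q) : Prop :=
  ∀ a : A.Obj, A.hom a a = 𝟙 (A.ty a)

/-- The one-object structure `*_e` on an arrow `e : X ⟶ X`. -/
def single (X : Q) (e : X ⟶ X) : QGraph Q :=
  ⟨PUnit, fun _ => X, fun _ _ => e⟩

/-- Full subgraph determined by a subset of the objects. -/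
def restrict (A : QGraph Q) (s : Set A.Obj) : QGraph Q :=
  ⟨s, fun x => A.ty x, fun x y => A.hom x y⟩

end QGraph

/-- A matrix of `Q`-arrows: `Φ a b : ty a ⟶ ty b` is the paper's `Φ(b,a) : ta → tb`. -/
def QMat (A B : QGraph Q) : Type u :=
  ∀ (a : A.Obj) (b : B.Obj), A.ty a ⟶ B.ty b

/-- Composition of matrices: `(Ψ⊗Φ)(c,a) = ⋁_b Ψ(c,b)∘Φ(b,a)`. -/
def matComp {A B C : QGraph Q} (Φ : QMat A B) (Ψ : QMat B C) : QMat A C :=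
  fun a c => ⨆ b, Φ a b ≫ Ψ b c

/-- (Plain) distributor between `Q`-categories. -/
def IsDist {A B : QGraph Q} (Φ : QMat A B) : Prop :=
  (∀ (a : A.Obj) (b b' : B.Obj), Φ a b ≫ B.hom b b' ≤ Φ a b') ∧
  (∀ (a' a : A.Obj) (b : B.Obj), A.hom a' a ≫ Φ a b ≤ Φ a' b)

/-- Regular semidistributor. -/
def IsRSDist {A B : QGraph Q} (Φ : QMat A B) : Prop :=
  (∀ (a : A.Obj) (b' : B.Obj), (⨆ b, Φ a b ≫ B.hom b b') = Φ a b') ∧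
  (∀ (a' : A.Obj) (b : B.Obj), (⨆ a, A.hom a' a ≫ Φ a b) = Φ a' b)

/-- Adjunction `Φ ⊣ Ψ` (unit and counit inequalities) between matrices. -/
def MatAdj {A B : QGraph Q} (Φ : QMat A B) (Ψ : QMat B A) : Prop :=
  (∀ a a', A.hom a a' ≤ matComp Φ Ψ a a') ∧
  (∀ b b', matComp Ψ Φ b b' ≤ B.hom b b')

/-- A type-preserving object map. -/
structure ObjMap (A B : QGraph Q) where
  map : A.Obj → B.Obj
  ty_eq : ∀ a, B.ty (map a) = A.ty a

namespace ObjMap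

variable {A B C : QGraph Q}

/-- The matrix `B(-,F-)` induced by an object map. -/
def graph (F : ObjMap A B) : QMat A B :=
  fun a b => eqToHom (F.ty_eq a).symm ≫ B.hom (F.map a) b

/-- The matrix `B(F-,-)` induced by an object map. -/
def cograph (F : ObjMap A B) : QMat B A :=
  fun b a => B.hom b (F.map a) ≫ eqToHom (F.ty_eq a)

/-- Semifunctor: `A(a',a) ≤ B(Fa',Fa)`. -/
def IsSemiFun (F : ObjMap A B) : Prop :=
  ∀ a a', A.hom a a' ≤
    eqToHom (F.ty_eq a).symm ≫ B.hom (F.map a) (F.map a') ≫ eqToHom (F.ty_eq a')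

/-- Fully faithful semifunctor: `A(a',a) = B(Fa',Fa)`. -/
def IsFullyFaithful (F : ObjMap A B) : Prop :=
  ∀ a a', A.hom a a' =
    eqToHom (F.ty_eq a).symm ≫ B.hom (F.map a) (F.map a') ≫ eqToHom (F.ty_eq a')

/-- Regular semifunctor: a semifunctor such that `⋁_{a'} B(b,Fa')∘A(a',a) = B(b,Fa)` and
`⋁_{a'} A(a,a')∘B(Fa',b) = B(Fa,b)`. -/
def IsRSFun (F : ObjMap A B) : Prop :=
  F.IsSemiFun ∧
  (∀ a b, (⨆ a', A.hom a a' ≫ F.graph a' b) = F.graph a b) ∧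
  (∀ a b, (⨆ a', F.cograph b a' ≫ A.hom a' a) = F.cograph b a)

/-- Composition of object maps (`G ∘ F`). -/
def comp (F : ObjMap A B) (G : ObjMap B C) : ObjMap A C :=
  ⟨fun a => G.map (F.map a), fun a => (G.ty_eq (F.map a)).trans (F.ty_eq a)⟩

end ObjMap

/-- A left adjoint matrix `Φ` (with right adjoint `Ψ`) converges when it is induced by a
regular semifunctor, i.e. `Φ = B(-,F-)` and `Ψ = B(F-,-)`. -/
def Converges {A B : QGraph Q} (Φ : QMat A B) (Ψ : QMat B A) : Prop :=
  ∃ F : ObjMap A B, F.IsRSFun ∧ (∀ a b, Φ a b = F.graph a b) ∧ (∀ b a, Ψ b a = F.cograph b a)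

/-- Cauchy completeness of a totally regular `Q`-semicategory:
every Cauchy (left adjoint) regular semidistributor into it converges. -/
def CauchyComplete (B : QGraph Q) : Prop :=
  ∀ (A : QGraph Q), A.IsTR → ∀ (Φ : QMat A B) (Ψ : QMat B A),
    IsRSDist Φ → IsRSDist Ψ → MatAdj Φ Ψ → Converges Φ Ψ

/-- Cauchy completeness of a `Q`-category: every left adjoint distributor into it
is induced by a functor. -/
def CatCauchyComplete (B : QGraph Q) : Prop :=
  ∀ (A : QGraph Q), A.IsCat → ∀ (Φ : QMat A B) (Ψ : QMat B A),
    IsDist Φ → IsDist Ψ → MatAdj Φ Ψ →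
    ∃ F : ObjMap A B, F.IsSemiFun ∧ ∀ a b, Φ a b = F.graph a b

/-- An object `a` of a regular `Q`-semicategory is stable when it is the value of a regular
semifunctor on a one-object regular `Q`-semicategory `*_e` (`e` an idempotent). -/
def QGraph.Stable (A : QGraph Q) (a : A.Obj) : Prop :=
  ∃ (X : Q) (e : X ⟶ X), e ≫ e = e ∧
    ∃ F : ObjMap (QGraph.single X e) A, F.IsRSFun ∧ F.map PUnit.unit = a

/-- An object of the Cauchy completion of `B`: a left adjoint regular semidistributor
`φ : *_e ⇸ B` (for an idempotent `e : X ⟶ X` of `Q`) together with its right adjoint `ψ`. -/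
structure CCObj (B : QGraph Q) where
  X : Q
  e : X ⟶ X
  idem : e ≫ e = e
  φ : ∀ b : B.Obj, X ⟶ B.ty b
  ψ : ∀ b : B.Obj, B.ty b ⟶ X
  φ_regl : ∀ b', (⨆ b, φ b ≫ B.hom b b') = φ b'
  φ_regr : ∀ b, e ≫ φ b = φ b
  ψ_regl : ∀ b, ψ b ≫ e = ψ b
  ψ_regr : ∀ b', (⨆ b, B.hom b' b ≫ ψ b) = ψ b'
  unit : e ≤ ⨆ b, φ b ≫ ψ b
  counit : ∀ b b', ψ b ≫ φ b' ≤ B.hom b b'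

/-- The Cauchy completion `B_cc`; its hom-arrow from `p` to `q` is `B_cc(q,p) = q* ⊗ p`,
i.e. the lifting `[q,p]` in `TRSDist(Q)`. -/
def QGraph.cc (B : QGraph Q) : QGraph Q :=
  ⟨CCObj B, fun p => p.X, fun p q => ⨆ b, p.φ b ≫ q.ψ b⟩

/-- The object `k_B b`, i.e. the left adjoint `B(-,b) : *_{B(b,b)} ⇸ B` with right
adjoint `B(b,-)`. -/
def kObj {B : QGraph Q} (hB : B.IsTR) (b : B.Obj) : CCObj B where
  X := B.ty b
  e := B.hom b b
  idem := hB.2.1 b b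
  φ := fun y => B.hom b y
  ψ := fun y => B.hom y b
  φ_regl := fun b' =>
    le_antisymm (iSup_le fun y => hB.1 b y b') (le_iSup_of_le b (hB.2.1 b b').ge)
  φ_regr := fun y => hB.2.1 b y
  ψ_regl := fun y => hB.2.2 b y
  ψ_regr := fun b' =>
    le_antisymm (iSup_le fun y => hB.1 b' y b) (le_iSup_of_le b (hB.2.2 b b').ge)
  unit := le_iSup_of_le b (hB.2.1 b b).ge
  counit := fun y y' => hB.1 y b y'

/-- The Cauchy completion embedding `k_B : B → B_cc`. -/
def kMap {B : QGraph Q} (hB : B.IsTR) : ObjMap B (QGraph.cc B) :=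
  ⟨fun b => kObj hB b, fun _ => rfl⟩

namespace IsQuantaloid

variable [IsQuantaloid Q] {X Y Z : Q}

theorem comp_iSup {ι : Sort*} (f : X ⟶ Y) (g : ι → (Y ⟶ Z)) :
    f ≫ (⨆ i, g i) = ⨆ i, f ≫ g i := by
  rw [iSup, comp_sSup, iSup_range]

theorem iSup_comp {ι : Sort*} (f : ι → (X ⟶ Y)) (g : Y ⟶ Z) :
    (⨆ i, f i) ≫ g = ⨆ i, f i ≫ g := by
  rw [iSup, sSup_comp, iSup_range]

theorem comp_mono {f f' : X ⟶ Y} {g g' : Y ⟶ Z} (hf : f ≤ f') (hg : g ≤ g') :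
    f ≫ g ≤ f' ≫ g' := by
  have h₁ := comp_sSup f {g, g'}
  have h₂ := sSup_comp {f, f'} g'
  rw [sSup_pair, sup_eq_right.2 hg, iSup_pair] at h₁
  rw [sSup_pair, sup_eq_right.2 hf, iSup_pair] at h₂
  exact (le_sup_left.trans h₁.ge).trans (le_sup_left.trans h₂.ge)

end IsQuantaloid

open IsQuantaloid

namespace IsRSDist

variable {A B : QGraph Q} {Φ : QMat A B}

theorem comp_hom_le (hΦ : IsRSDist Φ) (a : A.Obj) (b b' : B.Obj) :
    Φ a b ≫ B.hom b b' ≤ Φ a b' :=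
  (le_iSup (fun b => Φ a b ≫ B.hom b b') b).trans (hΦ.1 a b').le

theorem hom_comp_le (hΦ : IsRSDist Φ) (a' a : A.Obj) (b : B.Obj) :
    A.hom a' a ≫ Φ a b ≤ Φ a' b :=
  (le_iSup (fun a => A.hom a' a ≫ Φ a b) a).trans (hΦ.2 a' b).le

theorem hom_self_comp [IsQuantaloid Q] (hΦ : IsRSDist Φ) (hA : A.IsTR) (a : A.Obj)
    (b : B.Obj) : A.hom a a ≫ Φ a b = Φ a b := by
  rw [← hΦ.2 a b, comp_iSup]
  simp_rw [← Category.assoc, hA.2.1]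

theorem comp_hom_self [IsQuantaloid Q] (hΦ : IsRSDist Φ) (hB : B.IsTR) (a : A.Obj)
    (b : B.Obj) : Φ a b ≫ B.hom b b = Φ a b := by
  rw [← hΦ.1 a b, iSup_comp]
  simp_rw [Category.assoc, hB.2.2]

end IsRSDist

namespace CCObj

variable {B : QGraph Q}

theorem φ_comp_hom_le (p : CCObj B) (b b' : B.Obj) : p.φ b ≫ B.hom b b' ≤ p.φ b' :=
  (le_iSup (fun b => p.φ b ≫ B.hom b b') b).trans (p.φ_regl b').le

theorem comp_le_hom (p q : CCObj B) (b : B.Obj) :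
    p.φ b ≫ q.ψ b ≤ (QGraph.cc B).hom p q :=
  le_iSup (fun b => p.φ b ≫ q.ψ b) b

theorem hom_kObj (hB : B.IsTR) (p : CCObj B) (b : B.Obj) :
    (QGraph.cc B).hom p (kObj hB b) = p.φ b :=
  p.φ_regl b

theorem kObj_hom (hB : B.IsTR) (p : CCObj B) (b : B.Obj) :
    (QGraph.cc B).hom (kObj hB b) p = p.ψ b :=
  p.ψ_regr b

end CCObj

theorem cc_isTR [IsQuantaloid Q] (B : QGraph Q) : (QGraph.cc B).IsTR := by
  have semi : (QGraph.cc B).IsSemiCat := fun p q r => by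
    change (⨆ b, p.φ b ≫ q.ψ b) ≫ (⨆ b, q.φ b ≫ r.ψ b) ≤ _
    rw [iSup_comp]
    refine iSup_le fun b => ?_
    rw [comp_iSup]
    refine iSup_le fun b' => ?_
    calc (p.φ b ≫ q.ψ b) ≫ q.φ b' ≫ r.ψ b'
        = (p.φ b ≫ q.ψ b ≫ q.φ b') ≫ r.ψ b' := by simp only [Category.assoc]
      _ ≤ p.φ b' ≫ r.ψ b' := comp_mono
          ((comp_mono le_rfl (q.counit b b')).trans (p.φ_comp_hom_le b b')) le_rfl
      _ ≤ ⨆ b, p.φ b ≫ r.ψ b := p.comp_le_hom r b'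
  refine ⟨semi, fun p q => le_antisymm (semi p p q) ?_, fun q p => le_antisymm (semi p q q) ?_⟩
  · refine iSup_le fun b => ?_
    rw [← p.φ_regr b, Category.assoc]
    exact comp_mono p.unit (p.comp_le_hom q b)
  · refine iSup_le fun b => ?_
    rw [← q.ψ_regl b, ← Category.assoc]
    exact comp_mono (p.comp_le_hom q b) q.unit

section Convergence

variable {A B : QGraph Q} (hB : B.IsTR) {Φ : QMat A (QGraph.cc B)} {Ψ : QMat (QGraph.cc B) A}

theorem comp_φ_le (hΦ : IsRSDist Φ) (a : A.Obj) (p : CCObj B) (b : B.Obj) :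
    Φ a p ≫ p.φ b ≤ Φ a (kObj hB b) :=
  (congrArg (Φ a p ≫ ·) (p.hom_kObj hB b)).ge.trans (hΦ.comp_hom_le a p (kObj hB b))

theorem ψ_comp_le (hΨ : IsRSDist Ψ) (a : A.Obj) (p : CCObj B) (b : B.Obj) :
    p.ψ b ≫ Ψ p a ≤ Ψ (kObj hB b) a :=
  (congrArg (· ≫ Ψ p a) (p.kObj_hom hB b)).ge.trans (hΨ.hom_comp_le (kObj hB b) p a)

variable [IsQuantaloid Q]

theorem iSup_kObj_comp_ψ (hΦ : IsRSDist Φ) (a : A.Obj) (p : CCObj B) :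
    (⨆ b, Φ a (kObj hB b) ≫ p.ψ b) = Φ a p := by
  refine le_antisymm (iSup_le fun b => ?_) ?_
  · rw [← p.kObj_hom hB b]
    exact hΦ.comp_hom_le a (kObj hB b) p
  · rw [← hΦ.1 a p]
    refine iSup_le fun q => ?_
    refine (comp_iSup (Φ a q) _).le.trans (iSup_mono fun b => ?_)
    exact (Category.assoc _ _ _).ge.trans (comp_mono (comp_φ_le hB hΦ a q b) le_rfl)

theorem iSup_φ_comp_kObj (hΨ : IsRSDist Ψ) (a : A.Obj) (p : CCObj B) :
    (⨆ b, p.φ b ≫ Ψ (kObj hB b) a) = Ψ p a := by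
  refine le_antisymm (iSup_le fun b => ?_) ?_
  · rw [← p.hom_kObj hB b]
    exact hΨ.hom_comp_le p (kObj hB b) a
  · rw [← hΨ.2 p a]
    refine iSup_le fun q => ?_
    refine (iSup_comp _ (Ψ q a)).le.trans (iSup_mono fun b => ?_)
    exact (Category.assoc _ _ _).le.trans (comp_mono le_rfl (ψ_comp_le hB hΨ a q b))

theorem matComp_eq_iSup_kObj (hΦ : IsRSDist Φ) (hΨ : IsRSDist Ψ) (a a' : A.Obj) :
    matComp Φ Ψ a a' = ⨆ b, Φ a (kObj hB b) ≫ Ψ (kObj hB b) a' := by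
  refine le_antisymm (iSup_le fun p => ?_)
    (iSup_le fun b => le_iSup (fun p => Φ a p ≫ Ψ p a') (kObj hB b))
  rw [← iSup_kObj_comp_ψ hB hΦ a p]
  refine (iSup_comp _ (Ψ p a')).le.trans (iSup_mono fun b => ?_)
  exact (Category.assoc _ _ _).le.trans (comp_mono le_rfl (ψ_comp_le hB hΨ _ p b))

/-- The object of the Cauchy completion `B_cc` to which the column at `a` of a left adjoint
regular semidistributor `Φ ⊣ Ψ` into `B_cc` converges. -/
def limitObj (hA : A.IsTR) (hΦ : IsRSDist Φ) (hΨ : IsRSDist Ψ) (adj : MatAdj Φ Ψ)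
    (a : A.Obj) : CCObj B where
  X := A.ty a
  e := A.hom a a
  idem := hA.2.1 a a
  φ b := Φ a (kObj hB b)
  ψ b := Ψ (kObj hB b) a
  φ_regl b' := iSup_kObj_comp_ψ hB hΦ a (kObj hB b')
  φ_regr b := hΦ.hom_self_comp hA a (kObj hB b)
  ψ_regl b := hΨ.comp_hom_self hA (kObj hB b) a
  ψ_regr b' := iSup_φ_comp_kObj hB hΨ a (kObj hB b')
  unit := (adj.1 a a).trans (matComp_eq_iSup_kObj hB hΦ hΨ a a).le
  counit b b' :=
    (le_iSup (fun a => Ψ (kObj hB b) a ≫ Φ a (kObj hB b')) a).trans <|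
      (adj.2 (kObj hB b) (kObj hB b')).trans ((kObj hB b).hom_kObj hB _).le

/-- The object map sending `a` to the limit of the column of `Φ` at `a`. -/
def limitMap (hA : A.IsTR) (hΦ : IsRSDist Φ) (hΨ : IsRSDist Ψ) (adj : MatAdj Φ Ψ) :
    ObjMap A (QGraph.cc B) :=
  ⟨limitObj hB hA hΦ hΨ adj, fun _ => rfl⟩

theorem limitMap_graph (hA : A.IsTR) (hΦ : IsRSDist Φ) (hΨ : IsRSDist Ψ) (adj : MatAdj Φ Ψ)
    (a : A.Obj) (p : CCObj B) : (limitMap hB hA hΦ hΨ adj).graph a p = Φ a p :=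
  (Category.id_comp _).trans (iSup_kObj_comp_ψ hB hΦ a p)

theorem limitMap_cograph (hA : A.IsTR) (hΦ : IsRSDist Φ) (hΨ : IsRSDist Ψ) (adj : MatAdj Φ Ψ)
    (p : CCObj B) (a : A.Obj) : (limitMap hB hA hΦ hΨ adj).cograph p a = Ψ p a :=
  (Category.comp_id _).trans (iSup_φ_comp_kObj hB hΨ a p)

theorem limitMap_isRSFun (hA : A.IsTR) (hΦ : IsRSDist Φ) (hΨ : IsRSDist Ψ)
    (adj : MatAdj Φ Ψ) : (limitMap hB hA hΦ hΨ adj).IsRSFun := by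
  refine ⟨fun a a' => ?_, fun a p => ?_, fun a p => ?_⟩
  · refine ((adj.1 a a').trans (matComp_eq_iSup_kObj hB hΦ hΨ a a').le).trans (le_of_eq ?_)
    exact ((Category.id_comp _).trans (Category.comp_id _)).symm
  · have h a' := limitMap_graph hB hA hΦ hΨ adj a' p
    simp only [h]
    exact hΦ.2 a p
  · have h a' := limitMap_cograph hB hA hΦ hΨ adj p a'
    simp only [h]
    exact hΨ.1 p a

end Convergence

/-- the Cauchy completion `B_cc` of a totally regular `Q`-semicategory is a
Cauchy complete totally regular `Q`-semicategory: every left adjoint regular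
semidistributor into `B_cc` converges to a regular semifunctor. -/
theorem cc_cauchyComplete [IsQuantaloid Q] (B : QGraph Q) (hB : B.IsTR) :
    (QGraph.cc B).IsTR ∧ CauchyComplete (QGraph.cc B) := by
  refine ⟨cc_isTR B, fun A hA Φ Ψ hΦ hΨ adj => ?_⟩
  exact ⟨limitMap hB hA hΦ hΨ adj, limitMap_isRSFun hB hA hΦ hΨ adj,
    fun a p => (limitMap_graph hB hA hΦ hΨ adj a p).symm,
    fun p a => (limitMap_cograph hB hA hΦ hΨ adj p a).symm⟩
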